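/- For all positive integers N with ln ln N ≥ 1, we have ln|E_N| ≥ 2 ln 2 · N / ln N. -/

import Mathlib

/-- `E N`: the set of Egyptian fractions with denominators at most `N`,
i.e. all sums `∑_{n=1}^N t_n / n` with `t_n ∈ {0,1}`. -/
def egyptianSet (N : ℕ) : Finset ℚ :=
  (Finset.Icc 1 N).powerset.image (fun (S : Finset ℕ) => ∑ n ∈ S, (1 : ℚ) / (n : ℚ))

/-- the set `𝒰` -/
def InU (m : ℕ) : Prop :=
  ∀ w : ℕ → ℤ, (∀ n, w n = -1 ∨ w n = 0 ∨ w n = 1) →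
    ∑ n ∈ Finset.Ico 1 m, (w n : ℚ) / n ≠ 1 / m

open Classical in
/-- `𝒰(N)` -/
noncomputable def USet (N : ℕ) : Finset ℕ := (Finset.Icc 1 N).filter InU

lemma USet_inj_aux (N : ℕ) (A B : Finset ℕ) (hA : A ⊆ USet N) (hB : B ⊆ USet N)
    (h : ∑ n ∈ A, (1 : ℚ) / (n : ℚ) = ∑ n ∈ B, (1 : ℚ) / (n : ℚ)) (m : ℕ)
    (hmA : m ∈ A) (hmB : m ∉ B) (hmax : ∀ n, m < n → (n ∈ A ↔ n ∈ B)) : False := by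
  have hmU := hA hmA
  simp only [USet, Finset.mem_filter, Finset.mem_Icc] at hmU
  obtain ⟨⟨hm1, hmN⟩, hU⟩ := hmU
  have key : ∀ C : Finset ℕ, C ⊆ USet N → ∑ n ∈ C, (1 : ℚ) / (n : ℚ)
      = ∑ n ∈ Finset.Ico 1 (N + 1), (if n ∈ C then (1 : ℚ) else 0) / n := by
    intro C hC
    simp only [ite_div, zero_div]
    rw [← Finset.sum_filter]
    apply Finset.sum_congr _ (fun _ _ => rfl)
    ext n
    simp only [Finset.mem_filter, Finset.mem_Ico]
    constructor
    · intro hn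
      have := hC hn
      simp only [USet, Finset.mem_filter, Finset.mem_Icc] at this
      exact ⟨by omega, hn⟩
    · exact fun hn => hn.2
  rw [key A hA, key B hB] at h
  rw [← Finset.sum_Ico_consecutive _ (show 1 ≤ m by omega) (show m ≤ N + 1 by omega),
    ← Finset.sum_Ico_consecutive _ (show 1 ≤ m by omega) (show m ≤ N + 1 by omega),
    Finset.sum_eq_sum_Ico_succ_bot (show m < N + 1 by omega),
    Finset.sum_eq_sum_Ico_succ_bot (show m < N + 1 by omega)] at h
  have htail : ∑ n ∈ Finset.Ico (m + 1) (N + 1), (if n ∈ A then (1 : ℚ) else 0) / n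
      = ∑ n ∈ Finset.Ico (m + 1) (N + 1), (if n ∈ B then (1 : ℚ) else 0) / n := by
    apply Finset.sum_congr rfl
    intro n hn
    rw [Finset.mem_Ico] at hn
    simp only [hmax n (by omega)]
  rw [htail] at h
  simp only [hmA, hmB, if_true, if_false, zero_div] at h
  apply hU (fun n => (if n ∈ B then 1 else 0) - (if n ∈ A then 1 else 0))
  · intro n
    by_cases h1 : n ∈ A <;> by_cases h2 : n ∈ B <;> simp [h1, h2]
  · push_cast
    simp only [sub_div, Finset.sum_sub_distrib]
    linarith

lemma card_ge (N : ℕ) : 2 ^ (USet N).card ≤ (egyptianSet N).card := by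
  rw [← Finset.card_powerset]
  unfold egyptianSet
  have hsub : (USet N).powerset ⊆ (Finset.Icc 1 N).powerset := by
    apply Finset.powerset_mono.2
    classical
    unfold USet; exact Finset.filter_subset _ _
  refine le_trans ?_ (Finset.card_le_card (Finset.image_subset_image hsub))
  rw [Finset.card_image_of_injOn]
  intro A hA B hB h
  simp only [Finset.coe_powerset, Set.mem_preimage, Set.mem_powerset_iff, Finset.coe_subset] at hA hB
  by_contra hne
  have hne' : (symmDiff A B).Nonempty := by
    rw [Finset.nonempty_iff_ne_empty]
    intro h0
    exact hne (symmDiff_eq_bot.1 h0)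
  have hmem := Finset.max'_mem _ hne'
  have hmax : ∀ n, (symmDiff A B).max' hne' < n → (n ∈ A ↔ n ∈ B) := by
    intro n hn
    by_contra hc
    have : n ∈ symmDiff A B := by
      rw [Finset.mem_symmDiff]; tauto
    exact absurd (Finset.le_max' _ _ this) (by omega)
  rcases (Finset.mem_symmDiff.1 hmem) with ⟨h1, h2⟩ | ⟨h1, h2⟩
  · exact USet_inj_aux N A B hA hB h _ h1 h2 hmax
  · exact USet_inj_aux N B A hB hA h.symm _ h1 h2 (fun n hn => (hmax n hn).symm)

lemma inU_of (p k a : ℕ) (hp : p.Prime) (hk : 1 ≤ k) (hkp : k < p)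
    (hw : ∀ w : ℕ → ℤ, (∀ n, w n = -1 ∨ w n = 0 ∨ w n = 1) → ∃ z : ℤ, ¬ (p : ℤ) ∣ z ∧
      (k.factorial : ℚ) * (1 / k - ∑ j ∈ Finset.Ico 1 k, (w j : ℚ) / j) = z) :
    InU (k * p ^ a) := by
  intro w hw1 heq
  have : Fact p.Prime := ⟨hp⟩
  set q := p ^ a with hq
  have hq0 : 0 < q := pow_pos hp.pos _
  have hqQ : (q : ℚ) ≠ 0 := by positivity
  obtain ⟨z, hz, hzeq⟩ := hw (fun j => w (q * j)) (fun j => hw1 _)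
  have hnormz : padicNorm p (z : ℚ) = 1 := (padicNorm.int_eq_one_iff z).2 hz
  have hnormf : padicNorm p (k.factorial : ℚ) = 1 := by
    rw [padicNorm.nat_eq_one_iff, hp.dvd_factorial]; omega
  rw [← hzeq, padicNorm.mul, hnormf, one_mul] at hnormz
  have hsplit := Finset.sum_filter_add_sum_filter_not (Finset.Ico 1 (k * q)) (fun n => q ∣ n)
    (fun n => (w n : ℚ) / n)
  have hmul : ∑ n ∈ (Finset.Ico 1 (k * q)).filter (fun n => q ∣ n), (w n : ℚ) / n
      = ∑ j ∈ Finset.Ico 1 k, (w (q * j) : ℚ) / ((q * j : ℕ) : ℚ) := by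
    symm
    apply Finset.sum_nbij (fun j => q * j)
    · intro j hj
      simp only [Finset.mem_Ico, Finset.mem_filter] at hj ⊢
      refine ⟨⟨Nat.mul_pos hq0 (by omega), ?_⟩, dvd_mul_right _ _⟩
      rw [mul_comm k q]
      exact Nat.mul_lt_mul_of_pos_left hj.2 hq0
    · intro x _ y _ hxy
      exact Nat.eq_of_mul_eq_mul_left hq0 hxy
    · intro n hn
      simp only [Finset.coe_filter, Finset.mem_Ico, Set.mem_ofPred_eq] at hn
      obtain ⟨⟨h1, h2⟩, j, rfl⟩ := hn
      refine ⟨j, ?_, rfl⟩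
      simp only [Finset.coe_Ico, Set.mem_Ico]
      constructor
      · rcases Nat.eq_zero_or_pos j with h | h
        · subst h; simp at h1
        · exact h
      · rw [mul_comm k q] at h2
        exact Nat.lt_of_mul_lt_mul_left h2
    · intro j _; rfl
  have hr : (1 : ℚ) / k - ∑ j ∈ Finset.Ico 1 k, (w (q * j) : ℚ) / j
      = ∑ n ∈ (Finset.Ico 1 (k * q)).filter (fun n => ¬ q ∣ n), (q : ℚ) * ((w n : ℚ) / n) := by
    rw [← Finset.mul_sum]
    have h1 : ∑ j ∈ Finset.Ico 1 k, (w (q * j) : ℚ) / j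
        = q * ∑ j ∈ Finset.Ico 1 k, (w (q * j) : ℚ) / ((q * j : ℕ) : ℚ) := by
      rw [Finset.mul_sum]
      apply Finset.sum_congr rfl
      intro j hj
      rw [Finset.mem_Ico] at hj
      have : (j : ℚ) ≠ 0 := by
        have : 0 < j := by omega
        positivity
      push_cast
      field_simp
    have h2 : (1 : ℚ) / k = q * (1 / ((k * q : ℕ) : ℚ)) := by
      have : (k : ℚ) ≠ 0 := by positivity
      push_cast
      field_simp
    rw [h1, h2, ← heq, ← hsplit, hmul]
    ring
  rw [hr] at hnormz
  have hlt : padicNorm p (∑ n ∈ (Finset.Ico 1 (k * q)).filter (fun n => ¬ q ∣ n),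
      (q : ℚ) * ((w n : ℚ) / n)) < 1 := by
    apply padicNorm.sum_lt' _ one_pos
    intro n hn
    simp only [Finset.mem_Ico, Finset.mem_filter] at hn
    obtain ⟨⟨h1, -⟩, h3⟩ := hn
    have h4 : ¬ padicNorm p ((n : ℤ) : ℚ) ≤ (p : ℚ) ^ (-a : ℤ) := by
      rw [← padicNorm.dvd_iff_norm_le]
      rw [hq] at h3
      exact_mod_cast h3
    push Not at h4
    have h5 : padicNorm p (q : ℚ) ≤ (p : ℚ) ^ (-a : ℤ) := by
      have := (padicNorm.dvd_iff_norm_le (p := p) (n := a) (z := (q : ℤ))).1 (by rw [hq])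
      exact_mod_cast this
    have h6 : padicNorm p (w n : ℚ) ≤ 1 := padicNorm.of_int _
    have h7 : padicNorm p (q : ℚ) < padicNorm p (n : ℚ) := lt_of_le_of_lt h5 (by exact_mod_cast h4)
    have h8 : 0 < padicNorm p (n : ℚ) := lt_of_le_of_lt (padicNorm.nonneg _) h7
    rw [padicNorm.mul, padicNorm.div, ← mul_div_assoc, div_lt_one h8]
    calc _ ≤ padicNorm p (q : ℚ) * 1 := by
          apply mul_le_mul_of_nonneg_left h6 (padicNorm.nonneg _)
      _ < _ := by linarith
  linarith

/-- threshold for the prime -/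
def Bd : ℕ → ℕ
  | 1 => 1
  | 2 => 3
  | 3 => 11
  | 4 => 19
  | _ => 137

lemma ndvd_aux (p : ℕ) (hp : p.Prime) (c : ℕ) (B : ℕ) (z : ℤ) (hpB : B < p) (hc : c < p) (hc0 : 0 < c)
    (hz0 : z ≠ 0) (hz : |z| ≤ B) : ¬ (p : ℤ) ∣ c * z := by
  intro h
  rcases (Nat.prime_iff_prime_int.1 hp).dvd_or_dvd h with h | h
  · have := Nat.le_of_dvd hc0 (by exact_mod_cast h); omega
  · have h1 := Int.le_of_dvd (abs_pos.2 hz0) ((dvd_abs _ _).2 h); omega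

lemma inU_good (p k a : ℕ) (hp : p.Prime) (hk : 1 ≤ k) (hk5 : k ≤ 5) (hB : Bd k < p) :
    InU (k * p ^ a) := by
  have hk' : k = 1 ∨ k = 2 ∨ k = 3 ∨ k = 4 ∨ k = 5 := by omega
  rcases hk' with rfl | rfl | rfl | rfl | rfl <;> simp only [Bd] at hB
  · apply inU_of p 1 a hp hk (by omega)
    intro w hw
    refine ⟨1, ?_, by norm_num⟩
    have := ndvd_aux p hp 1 1 1 (by omega) (by omega) (by omega) (by omega) (by norm_num)
    simpa using this
  · apply inU_of p 2 a hp hk (by omega)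
    intro w hw
    refine ⟨(1 : ℕ) * (1 - 2 * w 1), ndvd_aux p hp 1 3 _ hB (by omega) (by omega) ?_ ?_, ?_⟩
    · have := hw 1; omega
    · have := hw 1; rw [abs_le]; omega
    · simp [Finset.sum_Ico_succ_top, Nat.factorial]; ring
  · apply inU_of p 3 a hp hk (by omega)
    intro w hw
    refine ⟨(1 : ℕ) * (2 - 6 * w 1 - 3 * w 2), ndvd_aux p hp 1 11 _ hB (by omega) (by omega) ?_ ?_, ?_⟩
    · have := hw 1; have := hw 2; omega
    · have := hw 1; have := hw 2; rw [abs_le]; omega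
    · simp [Finset.sum_Ico_succ_top, Nat.factorial]; ring
  · apply inU_of p 4 a hp hk (by omega)
    intro w hw
    by_cases h25 : |3 - 12 * w 1 - 6 * w 2 - 4 * w 3| ≤ 22
    · refine ⟨(2 : ℕ) * (3 - 12 * w 1 - 6 * w 2 - 4 * w 3), ?_, ?_⟩
      · have hp22 : 22 < p := by
          by_contra hc
          have : p = 20 ∨ p = 21 ∨ p = 22 := by omega
          rcases this with rfl | rfl | rfl <;> norm_num at hp
        refine ndvd_aux p hp 2 22 _ hp22 (by omega) (by omega) ?_ h25
        have := hw 1; have := hw 2; have := hw 3; omega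
      · simp [Finset.sum_Ico_succ_top, Nat.factorial]; ring
    · have h : 3 - 12 * w 1 - 6 * w 2 - 4 * w 3 = 25 := by
        have h1 := hw 1; have h2 := hw 2; have h3 := hw 3
        rw [abs_le] at h25; omega
      refine ⟨((2 : ℕ) * (5 * 5)), ?_, ?_⟩
      · intro hd
        have h2 : p ∣ 2 * (5 * 5) := by exact_mod_cast hd
        rcases (Nat.Prime.dvd_mul hp).1 h2 with h2 | h2
        · have := Nat.le_of_dvd (by norm_num) h2; omega
        · rcases (Nat.Prime.dvd_mul hp).1 h2 with h2 | h2 <;>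
          · have := Nat.le_of_dvd (by norm_num) h2; omega
      · have h' : (3 - 12 * w 1 - 6 * w 2 - 4 * w 3 : ℚ) = 25 := by exact_mod_cast h
        simp [Finset.sum_Ico_succ_top, Nat.factorial]; linarith
  · apply inU_of p 5 a hp hk (by omega)
    intro w hw
    refine ⟨(2 : ℕ) * (12 - 60 * w 1 - 30 * w 2 - 20 * w 3 - 15 * w 4),
      ndvd_aux p hp 2 137 _ hB (by omega) (by omega) ?_ ?_, ?_⟩
    · have := hw 1; have := hw 2; have := hw 3; have := hw 4; omega
    · have := hw 1; have := hw 2; have := hw 3; have := hw 4; rw [abs_le]; omega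
    · simp [Finset.sum_Ico_succ_top, Nat.factorial]; ring
/-- product of the primes below 89 -/
def primProd : ℕ := 267064515689275851355624017992790

/-- primality test -/
def primeB (n : ℕ) : Bool :=
  (Nat.ble 2 n && Nat.ble n 7920) && (Nat.beq (Nat.gcd n primProd) 1 ||
    (Nat.ble n 83 && [2, 3, 5, 7, 11, 13, 17, 19, 23, 29, 31, 37, 41, 43, 47, 53, 59, 61, 67, 71, 73,
      79, 83].any (Nat.beq n)))

lemma primeB_sound (n : ℕ) (h : primeB n = true) : n.Prime := by
  simp only [primeB, Bool.and_eq_true, Bool.or_eq_true, Nat.ble_eq, Nat.beq_eq,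
    List.any_cons, List.any_nil] at h
  obtain ⟨⟨h2, h3⟩, h | ⟨-, h⟩⟩ := h
  · by_contra hn
    have hq := Nat.minFac_prime (show n ≠ 1 by omega)
    have hsq := Nat.minFac_sq_le_self (by omega) hn
    have hd := Nat.minFac_dvd n
    generalize n.minFac = q at *
    have hq89 : q < 89 := by
      by_contra hc
      have := Nat.pow_le_pow_left (show 89 ≤ q by omega) 2
      omega
    have : q ∣ primProd := by
      clear hsq hd h h3 h2 hn
      revert hq
      unfold primProd
      interval_cases q <;> norm_num
    have h1 := Nat.dvd_gcd hd this
    rw [h] at h1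
    exact hq.one_lt.ne' (Nat.dvd_one.1 h1)
  · simp at h
    rcases h with h | h | h | h | h | h | h | h | h | h | h | h | h | h | h | h | h | h | h | h | h |
      h | h <;> subst h <;> norm_num

/-- test for membership -/
def goodB (m : ℕ) : Bool :=
  primeB m
  || (Nat.beq (m % 2) 0 && Nat.ble 4 (m / 2) && primeB (m / 2))
  || (Nat.beq (m % 3) 0 && Nat.ble 12 (m / 3) && primeB (m / 3))
  || (Nat.beq (m % 4) 0 && Nat.ble 20 (m / 4) && primeB (m / 4))
  || (Nat.beq (m % 5) 0 && Nat.ble 138 (m / 5) && primeB (m / 5))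
  || (Nat.ble m 32 && [4, 8, 9, 16, 25, 27, 32].any (Nat.beq m))

lemma goodB_sound (m : ℕ) (h : goodB m = true) : InU m := by
  have aux : ∀ k, 1 ≤ k → k ≤ 5 → m % k = 0 → Bd k < m / k → primeB (m / k) = true → InU m := by
    intro k hk hk5 h0 h1 h2
    have := inU_good (m / k) k 1 (primeB_sound _ h2) hk hk5 h1
    rwa [pow_one, Nat.mul_div_cancel' (Nat.dvd_of_mod_eq_zero h0)] at this
  simp only [goodB, Bool.and_eq_true, Bool.or_eq_true, Nat.ble_eq, Nat.beq_eq,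
    List.any_cons, List.any_nil] at h
  rcases h with ((((h | h) | h) | h) | h) | h
  · have := inU_good m 1 1 (primeB_sound _ h) le_rfl (by norm_num) (primeB_sound _ h).one_lt
    simpa using this
  · exact aux 2 (by norm_num) (by norm_num) h.1.1 (by simp only [Bd]; omega) h.2
  · exact aux 3 (by norm_num) (by norm_num) h.1.1 (by simp only [Bd]; omega) h.2
  · exact aux 4 (by norm_num) (by norm_num) h.1.1 (by simp only [Bd]; omega) h.2
  · exact aux 5 (by norm_num) (by norm_num) h.1.1 (by simp only [Bd]; omega) h.2
  · have h2 : ∀ a, InU (2 ^ a) := fun a => by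
      simpa using inU_good 2 1 a (by norm_num) le_rfl (by norm_num) (by simp [Bd])
    have h3 : ∀ a, InU (3 ^ a) := fun a => by
      simpa using inU_good 3 1 a (by norm_num) le_rfl (by norm_num) (by simp [Bd])
    have h5 : ∀ a, InU (5 ^ a) := fun a => by
      simpa using inU_good 5 1 a (by norm_num) le_rfl (by norm_num) (by simp [Bd])
    have h := h.2
    simp at h
    rcases h with rfl | rfl | rfl | rfl | rfl | rfl | rfl
    · exact h2 2
    · exact h2 3
    · exact h3 2
    · exact h2 4
    · exact h5 2
    · exact h3 3
    · exact h2 5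

/-- number of good integers in (a, a+n] -/
def cr (a : ℕ) : ℕ → ℕ
  | 0 => 0
  | n + 1 => cr a n + cond (goodB (a + n + 1)) 1 0

lemma cr_sound (a n : ℕ) : (USet a).card + cr a n ≤ (USet (a + n)).card := by
  induction n with
  | zero => simp [cr]
  | succ n ih =>
    have hsub : USet (a + n) ⊆ USet (a + (n + 1)) := by
      classical
      unfold USet
      exact Finset.filter_subset_filter _ (Finset.Icc_subset_Icc_right (by omega))
    rw [cr]
    cases hg : goodB (a + n + 1) with
    | false =>
      have := Finset.card_le_card hsub
      simp only [cond_false]; omega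
    | true =>
      have hnot : a + n + 1 ∉ USet (a + n) := by
        simp [USet]
      have hin : a + n + 1 ∈ USet (a + (n + 1)) := by
        simp only [USet, Finset.mem_filter, Finset.mem_Icc]
        exact ⟨by omega, goodB_sound _ hg⟩
      have := Finset.card_le_card (Finset.insert_subset hin hsub)
      rw [Finset.card_insert_of_notMem hnot] at this
      simp only [cond_true]; omega

/-- verification of checkpoints -/
def ver : ℕ → ℕ → ℕ → List (ℕ × ℕ × ℕ) → Bool
  | _, _, _, [] => true
  | a, c, j, (a', c', j') :: l =>
    (Nat.ble a a' && Nat.ble c' (c + cr a (a' - a)) && Nat.ble (2 ^ j) (a ^ 8)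
      && Nat.ble (160000 * (a' - 1)) (c * j * 6931)) && ver a' c' j' l

/-- last checkpoint -/
def lastCk : ℕ → List (ℕ × ℕ × ℕ) → ℕ
  | a, [] => a
  | _, (a', _, _) :: l => lastCk a' l

lemma ver_sound (l : List (ℕ × ℕ × ℕ)) : ∀ a c j, 1 ≤ a → c ≤ (USet a).card → ver a c j l = true →
    ∀ N, a ≤ N → N < lastCk a l → 2 * (N : ℝ) ≤ (USet N).card * Real.log N := by
  induction l with
  | nil => intro a c j _ _ _ N h1 h2; simp only [lastCk] at h2; omega
  | cons x l ih =>
    obtain ⟨a', c', j'⟩ := x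
    intro a c j ha hc hv N h1 h2
    simp only [ver, Bool.and_eq_true, Nat.ble_eq] at hv
    obtain ⟨⟨⟨⟨v1, v2⟩, v3⟩, v4⟩, v5⟩ := hv
    simp only [lastCk] at h2
    by_cases hN : a' ≤ N
    · refine ih a' c' j' (by omega) ?_ v5 N hN h2
      have := cr_sound a (a' - a)
      rw [Nat.add_sub_cancel' v1] at this
      omega
    · have hcN : c ≤ (USet N).card := by
        have := cr_sound a (N - a)
        rw [Nat.add_sub_cancel' h1] at this
        omega
      have hcR : (c : ℝ) ≤ (USet N).card := by exact_mod_cast hcN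
      have haR : (1 : ℝ) ≤ a := by exact_mod_cast ha
      have hlog : (j : ℝ) * Real.log 2 ≤ 8 * Real.log a := by
        have h8 : ((2 : ℝ) ^ j) ≤ (a : ℝ) ^ 8 := by exact_mod_cast v3
        have := Real.log_le_log (by positivity) h8
        rw [Real.log_pow, Real.log_pow] at this
        exact_mod_cast this
      have hl2 := Real.log_two_gt_d9
      have hlaN : Real.log a ≤ Real.log N := Real.log_le_log (by linarith) (by exact_mod_cast h1)
      have hj : (j : ℝ) * 6931 ≤ 80000 * Real.log N := by
        have : (0 : ℝ) ≤ j := by positivity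
        nlinarith
      have h4 : 160000 * N ≤ c * j * 6931 := by
        refine le_trans ?_ v4
        apply Nat.mul_le_mul_left; omega
      have h4R : 160000 * (N : ℝ) ≤ c * j * 6931 := by exact_mod_cast h4
      have hlN : 0 ≤ Real.log N := Real.log_natCast_nonneg N
      have h5 : (c : ℝ) * (j * 6931) ≤ c * (80000 * Real.log N) :=
        mul_le_mul_of_nonneg_left hj (by positivity)
      have h6 : (c : ℝ) * Real.log N ≤ (USet N).card * Real.log N :=
        mul_le_mul_of_nonneg_right hcR hlN
      linarith

/-- checkpoints -/
def ckList : List (ℕ × ℕ × ℕ) :=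
  [(16, 12, 32), (17, 13, 32), (19, 14, 33), (21, 14, 35), (22, 15, 35), (23, 16, 36), (25, 17,
    37), (28, 19, 38), (32, 22, 40), (39, 26, 42), (48, 30, 44), (58, 34, 46), (68, 38, 48), (80,
    43, 50), (94, 51, 52), (115, 59, 54), (139, 70, 56), (170, 83, 59), (213, 102, 61), (270, 124,
    64), (344, 152, 67), (442, 187, 70), (568, 232, 73), (734, 291, 76), (959, 374, 79), (1280,
    483, 82), (1716, 629, 85), (2317, 826, 89), (3185, 1090, 93), (4392, 1451, 96), (6035, 1918,
    100), (7000, 2187, 0)]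

lemma small_case (N : ℕ) (h1 : 16 ≤ N) (h2 : N < 7000) :
    2 * (N : ℝ) ≤ (USet N).card * Real.log N := by
  have hv : ver 16 12 32 ckList = true := by decide +kernel
  have hl : lastCk 16 ckList = 7000 := by decide +kernel
  have h0 : 12 ≤ cr 0 16 := by decide +kernel
  have hc := cr_sound 0 16
  rw [zero_add] at hc
  exact ver_sound ckList 16 12 32 (by norm_num) (by omega) hv N h1 (by omega)

lemma log_fact_eq (M n : ℕ) (h : n ≤ M) : Real.log (n.factorial : ℝ)
    = ∑ i ∈ Finset.Ioc 0 M, ArithmeticFunction.vonMangoldt i * ((n / i : ℕ) : ℝ) := by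
  have h1 := ArithmeticFunction.sum_Ioc_mul_zeta_eq_sum ArithmeticFunction.vonMangoldt n
  rw [ArithmeticFunction.vonMangoldt_mul_zeta] at h1
  have h2 : ∑ i ∈ Finset.Ioc 0 n, ArithmeticFunction.vonMangoldt i * ((n / i : ℕ) : ℝ)
      = ∑ i ∈ Finset.Ioc 0 M, ArithmeticFunction.vonMangoldt i * ((n / i : ℕ) : ℝ) := by
    apply Finset.sum_subset (Finset.Ioc_subset_Ioc_right h)
    intro i hi hi'
    simp only [Finset.mem_Ioc] at hi hi'
    rw [Nat.div_eq_of_lt (by omega)]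
    simp
  rw [← h2, ← h1]
  clear h1 h2 h
  induction n with
  | zero => simp
  | succ n ih =>
    rw [Finset.sum_Ioc_succ_top (by omega), ← ih, Nat.factorial_succ, Nat.cast_mul,
      Real.log_mul (by positivity) (by positivity), ArithmeticFunction.log_apply]
    ring

lemma cheb_coeff (u : ℕ) : u + u / 30 ≤ u / 2 + u / 3 + u / 5 + 1 := by
  omega

lemma psi_ge_fact (M : ℕ) : Real.log (M.factorial : ℝ) - Real.log ((M / 2).factorial : ℝ)
    - Real.log ((M / 3).factorial : ℝ) - Real.log ((M / 5).factorial : ℝ)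
    + Real.log ((M / 30).factorial : ℝ) ≤ Chebyshev.psi M := by
  rw [log_fact_eq M M le_rfl, log_fact_eq M (M / 2) (Nat.div_le_self _ _),
    log_fact_eq M (M / 3) (Nat.div_le_self _ _), log_fact_eq M (M / 5) (Nat.div_le_self _ _),
    log_fact_eq M (M / 30) (Nat.div_le_self _ _), Chebyshev.psi, Nat.floor_natCast,
    ← Finset.sum_sub_distrib, ← Finset.sum_sub_distrib, ← Finset.sum_sub_distrib,
    ← Finset.sum_add_distrib]
  apply Finset.sum_le_sum
  intro i _
  have hc := cheb_coeff (M / i)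
  rw [Nat.div_div_eq_div_mul, Nat.div_div_eq_div_mul, Nat.div_div_eq_div_mul,
    Nat.div_div_eq_div_mul, mul_comm i 30, mul_comm i 2, mul_comm i 3, mul_comm i 5,
    ← Nat.div_div_eq_div_mul, ← Nat.div_div_eq_div_mul, ← Nat.div_div_eq_div_mul,
    ← Nat.div_div_eq_div_mul] at hc
  have hcR : ((M / i : ℕ) : ℝ) + ((M / 30 / i : ℕ) : ℝ) ≤ ((M / 2 / i : ℕ) : ℝ)
    + ((M / 3 / i : ℕ) : ℝ) + ((M / 5 / i : ℕ) : ℝ) + 1 := by exact_mod_cast hc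
  have hL : 0 ≤ ArithmeticFunction.vonMangoldt i := ArithmeticFunction.vonMangoldt_nonneg
  nlinarith

lemma log_fact_le (n : ℕ) : Real.log ((n + 1).factorial : ℝ)
    ≤ ((n : ℝ) + 2) * Real.log (n + 1) - (n + 1) + 1 := by
  induction n with
  | zero => simp
  | succ n ih =>
    rw [Nat.factorial_succ, Nat.cast_mul, Real.log_mul (by positivity) (by positivity)]
    push_cast
    have h1 : (0 : ℝ) < n + 1 := by positivity
    have h2 : (0 : ℝ) < n + 1 + 1 := by positivity
    have h3 := Real.log_le_sub_one_of_pos (div_pos h1 h2)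
    rw [Real.log_div h1.ne' h2.ne'] at h3
    have h4 : ((n : ℝ) + 1) / (n + 1 + 1) - 1 = - (1 / (n + 1 + 1)) := by field_simp; ring
    rw [h4] at h3
    have h5 : ((n : ℝ) + 1 + 1) * (Real.log (n + 1) - Real.log (n + 1 + 1)) ≤ - 1 := by
      calc _ ≤ ((n : ℝ) + 1 + 1) * (- (1 / (n + 1 + 1))) := mul_le_mul_of_nonneg_left h3 h2.le
        _ = -1 := by field_simp
    nlinarith

lemma log_fact_upper (n : ℕ) (y : ℝ) (hn : 1 ≤ n) (h1 : (n : ℝ) ≤ y) (h2 : y < n + 1) :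
    Real.log (n.factorial : ℝ) ≤ (y + 1) * Real.log y - y + 1 := by
  obtain ⟨m, rfl⟩ : ∃ m, n = m + 1 := ⟨n - 1, by omega⟩
  have h := log_fact_le m
  push_cast at h1 h2
  set x : ℝ := (m : ℝ) + 1 with hx
  have hx0 : (1 : ℝ) ≤ x := by rw [hx]; linarith [(Nat.cast_nonneg m : (0 : ℝ) ≤ m)]
  have hy0 : 0 < y := by linarith
  have h3 := Real.log_le_sub_one_of_pos (div_pos (by linarith : 0 < x) hy0)
  rw [Real.log_div (by linarith) (by linarith)] at h3
  have h4 : (x + 1) * (Real.log x - Real.log y) ≤ - (y - x) := by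
    calc _ ≤ (x + 1) * (x / y - 1) := mul_le_mul_of_nonneg_left h3 (by linarith)
      _ = - ((x + 1) / y * (y - x)) := by field_simp; ring
      _ ≤ - (y - x) := by
        have : 1 ≤ (x + 1) / y := by rw [le_div_iff₀ hy0]; linarith
        nlinarith
  have h5 : 0 ≤ (y - x) * Real.log y := mul_nonneg (by linarith) (Real.log_nonneg (by linarith))
  have h6 : (m : ℝ) + 2 = x + 1 := by rw [hx]; ring
  rw [h6] at h
  nlinarith

lemma log_fact_lower' (n : ℕ) (hn : n ≠ 0) :
    (n : ℝ) * Real.log n - n ≤ Real.log (n.factorial : ℝ) ∧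
    (n : ℝ) * Real.log n - n + Real.log n / 2 ≤ Real.log (n.factorial : ℝ) := by
  have h := Stirling.le_log_factorial_stirling hn
  have h1 : 0 ≤ Real.log n := Real.log_natCast_nonneg n
  have h2 : 0 ≤ Real.log (2 * Real.pi) := Real.log_nonneg (by linarith [Real.pi_gt_three])
  constructor <;> linarith

lemma log_fact_lower (n : ℕ) (y : ℝ) (hy : 1 ≤ y) (h1 : (n : ℝ) ≤ y) (h2 : y < n + 1) :
    y * Real.log y - y - Real.log y - 1 ≤ Real.log (n.factorial : ℝ) := by
  have h := (log_fact_lower' (n + 1) (by omega)).1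
  rw [Nat.factorial_succ, Nat.cast_mul, Real.log_mul (by positivity) (by positivity)] at h
  push_cast at h
  have h3 : Real.log y ≤ Real.log ((n : ℝ) + 1) := Real.log_le_log (by linarith) h2.le
  have h4 : 0 ≤ Real.log y := Real.log_nonneg hy
  have h5 : (n : ℝ) * Real.log y ≤ n * Real.log (n + 1) :=
    mul_le_mul_of_nonneg_left h3 (by positivity)
  have h6 : (y - 1) * Real.log y ≤ n * Real.log y :=
    mul_le_mul_of_nonneg_right (by linarith) h4
  nlinarith

lemma div_bounds (M d : ℕ) (hd : 0 < d) :
    ((M / d : ℕ) : ℝ) ≤ (M : ℝ) / d ∧ (M : ℝ) / d < ((M / d : ℕ) : ℝ) + 1 := by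
  refine ⟨Nat.cast_div_le, ?_⟩
  have hdR : (0 : ℝ) < d := by exact_mod_cast hd
  rw [div_lt_iff₀ hdR]
  have := Nat.lt_div_mul_add (a := M) hd
  have h2 : M < (M / d + 1) * d := by rw [add_mul, one_mul]; exact this
  exact_mod_cast h2

lemma const_bound : (27.6 : ℝ) ≤ 14 * Real.log 2 + 9 * Real.log 3 + 5 * Real.log 5 := by
  have h1 : 14 * Real.log 2 + 9 * Real.log 3 + 5 * Real.log 5
      = Real.log (2 ^ 14 * 3 ^ 9 * 5 ^ 5) := by
    rw [Real.log_mul (by norm_num) (by norm_num), Real.log_mul (by norm_num) (by norm_num),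
      Real.log_pow, Real.log_pow, Real.log_pow]
    norm_num
  rw [h1]
  have h2 : (138 : ℝ) ≤ 5 * Real.log (2 ^ 14 * 3 ^ 9 * 5 ^ 5) := by
    have h3 : (5 : ℝ) * Real.log (2 ^ 14 * 3 ^ 9 * 5 ^ 5)
        = Real.log ((2 ^ 14 * 3 ^ 9 * 5 ^ 5) ^ 5) := by
      rw [Real.log_pow (n := 5)]; norm_num
    rw [h3, Real.le_log_iff_exp_le (by positivity)]
    have h4 : Real.exp 138 = (Real.exp 1) ^ 138 := by
      rw [← Real.exp_nat_mul]; norm_num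
    rw [h4]
    calc (Real.exp 1) ^ 138 ≤ (2.7182818286 : ℝ) ^ 138 :=
          pow_le_pow_left₀ (Real.exp_pos _).le Real.exp_one_lt_d9.le _
      _ ≤ _ := by norm_num
  generalize Real.log (2 ^ 14 * 3 ^ 9 * 5 ^ 5) = t at h2
  norm_num
  linarith

lemma psi_lower (M : ℕ) (hM : 30 ≤ M) :
    0.92 * (M : ℝ) - 4 * Real.log M ≤ Chebyshev.psi M := by
  have h := psi_ge_fact M
  have hMR : (30 : ℝ) ≤ M := by exact_mod_cast hM
  have h1 := (log_fact_lower' M (by omega)).1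
  have b2 := div_bounds M 2 (by norm_num)
  have b3 := div_bounds M 3 (by norm_num)
  have b5 := div_bounds M 5 (by norm_num)
  have b30 := div_bounds M 30 (by norm_num)
  have u2 := log_fact_upper (M / 2) _ (by omega) b2.1 b2.2
  have u3 := log_fact_upper (M / 3) _ (by omega) b3.1 b3.2
  have u5 := log_fact_upper (M / 5) _ (by omega) b5.1 b5.2
  have l30 := log_fact_lower (M / 30) _ (by push_cast; linarith) b30.1 b30.2
  push_cast at u2 u3 u5 l30
  have hM0 : (M : ℝ) ≠ 0 := by linarith
  rw [Real.log_div hM0 (by norm_num)] at u2 u3 u5 l30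
  have e30 : Real.log 30 = Real.log 2 + Real.log 3 + Real.log 5 := by
    rw [← Real.log_mul (by norm_num) (by norm_num), ← Real.log_mul (by norm_num) (by norm_num)]
    norm_num
  have g30 : 2 ≤ Real.log 30 := by
    rw [Real.le_log_iff_exp_le (by norm_num)]
    have h4 : Real.exp 2 = (Real.exp 1) ^ 2 := by
      rw [← Real.exp_nat_mul]; norm_num
    rw [h4]
    calc (Real.exp 1) ^ 2 ≤ (2.7182818286 : ℝ) ^ 2 :=
          pow_le_pow_left₀ (Real.exp_pos _).le Real.exp_one_lt_d9.le _
      _ ≤ _ := by norm_num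
  have cb : 27.6 * (M : ℝ) ≤ (14 * Real.log 2 + 9 * Real.log 3 + 5 * Real.log 5) * M :=
    mul_le_mul_of_nonneg_right const_bound (by linarith)
  rw [e30] at l30 g30
  nlinarith

lemma le_Bd (k : ℕ) (h1 : 1 ≤ k) (h5 : k ≤ 5) : k ≤ Bd k := by
  interval_cases k <;> simp [Bd]

lemma inj_aux (k p a k' p' a' : ℕ) (hk : 1 ≤ k) (hp : p.Prime) (hp' : p'.Prime)
    (hkp : k < p) (hk' : 1 ≤ k') (hkp' : k' < p') (ha : 1 ≤ a) (ha' : 1 ≤ a')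
    (h : k * p ^ a = k' * p' ^ a') : k = k' ∧ p = p' ∧ a = a' := by
  have hpp : p = p' := by
    by_contra hne
    have h1 : p ∣ k' * p' ^ a' := h ▸ (dvd_mul_of_dvd_right (dvd_pow_self p (by omega)) k)
    have h2 : p' ∣ k * p ^ a := h ▸ (dvd_mul_of_dvd_right (dvd_pow_self p' (by omega)) k')
    have h3 : p ∣ k' := by
      rcases hp.dvd_mul.1 h1 with h1 | h1
      · exact h1
      · exact absurd ((Nat.prime_dvd_prime_iff_eq hp hp').1 (hp.dvd_of_dvd_pow h1)) hne
    have h4 : p' ∣ k := by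
      rcases hp'.dvd_mul.1 h2 with h2 | h2
      · exact h2
      · exact absurd ((Nat.prime_dvd_prime_iff_eq hp' hp).1 (hp'.dvd_of_dvd_pow h2)).symm hne
    have := Nat.le_of_dvd hk' h3
    have := Nat.le_of_dvd hk h4
    omega
  subst hpp
  have c : ∀ j b, 1 ≤ j → j < p → Nat.Coprime (p ^ b) j := fun j b h1 h2 =>
    Nat.Coprime.pow_left _ ((Nat.Prime.coprime_iff_not_dvd hp).2
      (fun hd => absurd (Nat.le_of_dvd h1 hd) (by omega)))
  have d1 : p ^ a ∣ p ^ a' := (c k' a hk' hkp').dvd_of_dvd_mul_left (h ▸ dvd_mul_left _ _)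
  have d2 : p ^ a' ∣ p ^ a := (c k a' hk hkp).dvd_of_dvd_mul_left (h ▸ dvd_mul_left _ _)
  have e := Nat.dvd_antisymm d1 d2
  rw [e] at h
  exact ⟨Nat.eq_of_mul_eq_mul_right (pow_pos hp.pos _) h, rfl, Nat.pow_right_injective hp.two_le e⟩

/-- index set -/
def idx (N : ℕ) : Finset (Σ _ : ℕ, Σ _ : ℕ, ℕ) :=
  (Finset.Icc 1 5).sigma (fun k => ((Nat.primesLE (N / k)).filter (fun p => Bd k < p)).sigma
    (fun p => Finset.Icc 1 (p.log (N / k))))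

lemma idx_card_le (N : ℕ) : (idx N).card ≤ (USet N).card := by
  apply Finset.card_le_card_of_injOn (fun x => x.1 * x.2.1 ^ x.2.2)
  · rintro ⟨k, p, a⟩ hx
    simp only [idx, Finset.coe_sigma, Set.mem_sigma_iff, Finset.mem_coe, Finset.mem_Icc,
      Finset.mem_sigma, Finset.mem_filter, Nat.mem_primesLE] at hx
    obtain ⟨⟨hk1, hk5⟩, ⟨⟨hpN, hp⟩, hB⟩, ha1, ha⟩ := hx
    simp only [USet, Finset.coe_filter, Finset.mem_Icc, Set.mem_ofPred_eq]
    have hle : p ^ a ≤ N / k := Nat.pow_le_of_le_log (by have := hp.pos; omega) ha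
    refine ⟨⟨Nat.mul_pos hk1 (pow_pos hp.pos _), ?_⟩, inU_good p k a hp hk1 hk5 hB⟩
    calc k * p ^ a ≤ k * (N / k) := Nat.mul_le_mul_left _ hle
      _ ≤ N := Nat.mul_div_le _ _
  · rintro ⟨k, p, a⟩ hx ⟨k', p', a'⟩ hx' h
    simp only [idx, Finset.mem_coe, Finset.mem_Icc,
      Finset.mem_sigma, Finset.mem_filter, Nat.mem_primesLE] at hx hx'
    obtain ⟨⟨hk1, hk5⟩, ⟨⟨hpN, hp⟩, hB⟩, ha1, ha⟩ := hx
    obtain ⟨⟨hk1', hk5'⟩, ⟨⟨hpN', hp'⟩, hB'⟩, ha1', ha'⟩ := hx'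
    have := le_Bd k hk1 hk5
    have := le_Bd k' hk1' hk5'
    obtain ⟨rfl, rfl, rfl⟩ := inj_aux k p a k' p' a' hk1 hp hp' (by omega) hk1' (by omega)
      ha1 ha1' h
    rfl

lemma psi_le_count (N M B : ℕ) (hM : 1 ≤ M) (hMN : M ≤ N) :
    Chebyshev.psi M ≤ ((∑ p ∈ (Nat.primesLE M).filter (fun p => B < p), p.log M : ℕ) : ℝ) * Real.log N
      + (Nat.primesLE B).card * Real.log N := by
  rw [Chebyshev.psi_eq_sum_mul_log_prime,
    ← Finset.sum_filter_add_sum_filter_not (Nat.primesLE M) (fun p => B < p)]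
  have hlN : 0 ≤ Real.log N := Real.log_natCast_nonneg N
  apply add_le_add
  · push_cast
    rw [Finset.sum_mul]
    apply Finset.sum_le_sum
    intro p hp
    simp only [Finset.mem_filter, Nat.mem_primesLE] at hp
    apply mul_le_mul_of_nonneg_left _ (by positivity)
    exact Real.log_le_log (by exact_mod_cast hp.1.2.pos) (by exact_mod_cast hp.1.1.trans hMN)
  · have hs : (Nat.primesLE M).filter (fun p => ¬ B < p) ⊆ Nat.primesLE B := by
      intro p hp
      simp only [Finset.mem_filter, Nat.mem_primesLE] at hp ⊢
      exact ⟨by omega, hp.1.2⟩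
    calc _ ≤ ∑ p ∈ (Nat.primesLE M).filter (fun p => ¬ B < p), Real.log N := by
          apply Finset.sum_le_sum
          intro p hp
          simp only [Finset.mem_filter, Nat.mem_primesLE] at hp
          rw [← Real.log_pow]
          apply Real.log_le_log (by have := hp.1.2.pos; positivity)
          exact_mod_cast (Nat.pow_log_le_self p (by omega)).trans hMN
      _ = ((Nat.primesLE M).filter (fun p => ¬ B < p)).card * Real.log N := by simp
      _ ≤ _ := by
        apply mul_le_mul_of_nonneg_right _ hlN
        exact_mod_cast Finset.card_le_card hs

lemma large_case (N : ℕ) (hN : 7000 ≤ N) : 2 * (N : ℝ) ≤ (USet N).card * Real.log N := by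
  have hNR : (7000 : ℝ) ≤ N := by exact_mod_cast hN
  have hlN : 0 ≤ Real.log N := Real.log_natCast_nonneg N
  have hcard : ((idx N).card : ℝ) ≤ (USet N).card := by exact_mod_cast idx_card_le N
  have hbig : ((idx N).card : ℝ) * Real.log N ≤ (USet N).card * Real.log N :=
    mul_le_mul_of_nonneg_right hcard hlN
  refine le_trans ?_ hbig
  have hidx : (idx N).card = ∑ k ∈ Finset.Icc 1 5,
      ∑ p ∈ (Nat.primesLE (N / k)).filter (fun p => Bd k < p), p.log (N / k) := by
    simp [idx, Finset.card_sigma]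
  have key : ∀ k ∈ Finset.Icc 1 5, 0.92 * (((N : ℝ) + 1) / k - 1) - 4 * Real.log N
      - (Nat.primesLE (Bd k)).card * Real.log N ≤
      ((∑ p ∈ (Nat.primesLE (N / k)).filter (fun p => Bd k < p), p.log (N / k) : ℕ) : ℝ)
        * Real.log N := by
    intro k hk
    rw [Finset.mem_Icc] at hk
    have hM30 : 30 ≤ N / k := by
      rw [Nat.le_div_iff_mul_le (by omega)]
      have : 30 * k ≤ 30 * 5 := Nat.mul_le_mul_left _ hk.2
      omega
    have hMN : N / k ≤ N := Nat.div_le_self _ _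
    have h1 := psi_lower (N / k) hM30
    have h2 := psi_le_count N (N / k) (Bd k) (by omega) hMN
    have h3 : Real.log ((N / k : ℕ) : ℝ) ≤ Real.log N :=
      Real.log_le_log (by exact_mod_cast (by omega : 0 < N / k)) (by exact_mod_cast hMN)
    have hk0 : (0 : ℝ) < k := by exact_mod_cast (by omega : 0 < k)
    have h4 : ((N : ℝ) + 1) / k - 1 ≤ ((N / k : ℕ) : ℝ) := by
      rw [sub_le_iff_le_add, div_le_iff₀ hk0]
      have := Nat.lt_div_mul_add (a := N) (b := k) (by omega)
      have h5 : N + 1 ≤ (N / k + 1) * k := by rw [add_mul, one_mul]; omega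
      exact_mod_cast h5
    linarith
  have hsum := Finset.sum_le_sum key
  rw [← Finset.sum_mul, ← Nat.cast_sum, ← hidx] at hsum
  refine le_trans ?_ hsum
  have c1 : (Nat.primesLE 1).card = 0 := by decide +kernel
  have c3 : (Nat.primesLE 3).card = 2 := by decide +kernel
  have c11 : (Nat.primesLE 11).card = 5 := by decide +kernel
  have c19 : (Nat.primesLE 19).card = 8 := by decide +kernel
  have c137 : (Nat.primesLE 137).card = 33 := by decide +kernel
  rw [show Finset.Icc 1 5 = ({1, 2, 3, 4, 5} : Finset ℕ) by decide]
  rw [Finset.sum_insert (by decide), Finset.sum_insert (by decide), Finset.sum_insert (by decide),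
    Finset.sum_insert (by decide), Finset.sum_singleton]
  simp only [Bd, c1, c3, c11, c19, c137]
  push_cast
  have hl7 : Real.log 7000 ≤ 8.9 := by
    rw [Real.log_le_iff_le_exp (by norm_num)]
    have h1 : Real.exp 8.9 = (Real.exp 0.1) ^ 89 := by
      rw [← Real.exp_nat_mul]; norm_num
    have h2 : (1.105 : ℝ) ≤ Real.exp 0.1 := by
      have := Real.quadratic_le_exp_of_nonneg (show (0 : ℝ) ≤ 0.1 by norm_num)
      norm_num at this ⊢
      linarith
    rw [h1]
    calc (7000 : ℝ) ≤ 1.105 ^ 89 := by norm_num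
      _ ≤ _ := pow_le_pow_left₀ (by norm_num) h2 _
  have hlog : Real.log N ≤ 8.9 + (N / 7000 - 1) := by
    have h1 := Real.log_le_sub_one_of_pos (show (0 : ℝ) < N / 7000 by positivity)
    rw [Real.log_div (by positivity) (by norm_num)] at h1
    linarith
  generalize Real.log N = t at *
  clear hsum key hidx hbig hcard c1 c3 c11 c19 c137 hl7
  linarith

theorem log_card_egyptianSet_ge (N : ℕ) (hN : 1 ≤ N)
    (h : 1 ≤ Real.log (Real.log N)) :
    2 * Real.log 2 * N / Real.log N ≤ Real.log ((egyptianSet N).card) := by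
  have hlN : 0 ≤ Real.log N := Real.log_natCast_nonneg N
  have hlpos : 0 < Real.log N := by
    rcases hlN.eq_or_lt with h0 | h0
    · rw [← h0] at h; simp at h; linarith
    · exact h0
  have he : Real.exp 1 ≤ Real.log N := (Real.le_log_iff_exp_le hlpos).1 h
  have hN16 : 16 ≤ N := by
    by_contra hc
    have h15 : (N : ℝ) ≤ 15 := by exact_mod_cast (by omega : N ≤ 15)
    have hN0 : (0 : ℝ) < N := by exact_mod_cast hN
    have h1 : Real.exp 2.718 ≤ 15 := by
      have h2 : (2.718 : ℝ) ≤ Real.log N := by linarith [Real.exp_one_gt_d9]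
      exact ((Real.le_log_iff_exp_le hN0).1 h2).trans h15
    have h2 : Real.exp 2.718 = (Real.exp 1) ^ 2 * Real.exp 0.718 := by
      rw [← Real.exp_nat_mul, ← Real.exp_add]; norm_num
    have h3 : (2.7182818283 : ℝ) ^ 2 ≤ (Real.exp 1) ^ 2 :=
      pow_le_pow_left₀ (by norm_num) Real.exp_one_gt_d9.le _
    have h4 : Real.exp 0.718 = (Real.exp 0.1795) ^ 4 := by
      rw [← Real.exp_nat_mul]; norm_num
    have h5 : (1.1956 : ℝ) ≤ Real.exp 0.1795 := by
      have := Real.quadratic_le_exp_of_nonneg (show (0 : ℝ) ≤ 0.1795 by norm_num)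
      norm_num at this ⊢
      linarith
    have h6 : (1.1956 : ℝ) ^ 4 ≤ (Real.exp 0.1795) ^ 4 := pow_le_pow_left₀ (by norm_num) h5 _
    rw [h2, h4] at h1
    have h7 := mul_le_mul h3 h6 (by positivity) (by positivity)
    norm_num at h7 h1
    linarith
  have hmain : 2 * (N : ℝ) ≤ (USet N).card * Real.log N := by
    rcases lt_or_ge N 7000 with h7 | h7
    · exact small_case N hN16 h7
    · exact large_case N h7
  have hcard : ((2 : ℝ) ^ (USet N).card) ≤ (egyptianSet N).card := by exact_mod_cast card_ge N
  have hl := Real.log_le_log (by positivity) hcard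
  rw [Real.log_pow] at hl
  refine le_trans ?_ hl
  rw [div_le_iff₀ hlpos]
  have := mul_le_mul_of_nonneg_right hmain (Real.log_nonneg (by norm_num : (1 : ℝ) ≤ 2))
  linarith
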